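/- Let G act on X, and let A, B ⊆ G and Y ⊆ X be finite nonempty. Then |AB · Y|² ≤ |AB| · |B · Y| · max_{b ∈ B} |Ab · Y|. In particular if every element of A commutes with every element of B, then |AB · Y|² ≤ |AB| · |B · Y| · |A · Y|. -/

import Mathlib

open Pointwise

/-- The inequality behind Cauchy–Schwarz for two summands, in a form free of square roots. -/
theorem add_sq_le_mul_add_mul_add {N n M P p Q q : ℕ} (hN : N ^ 2 ≤ P * (Q * M))
    (hn : n ^ 2 ≤ p * (q * M)) : (N + n) ^ 2 ≤ (P + p) * ((Q + q) * M) := by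
  have hsq : (2 * N * n) ^ 2 ≤ (M * (P * q + p * Q)) ^ 2 := by
    have hprod := Nat.mul_le_mul hN hn
    zify at hprod ⊢
    nlinarith [sq_nonneg ((M : ℤ) * (P * q - p * Q))]
  have hcross := (Nat.pow_le_pow_iff_left two_ne_zero).1 hsq
  nlinarith

theorem card_smul_sdiff_le_mul {G X : Type*} [Group G] [MulAction G X] [DecidableEq G]
    [DecidableEq X] (A B : Finset G) (Y : Finset X) (b : G) :
    (((A * {b}) • Y) \ ((A * B) • Y)).card ≤
      ((A * {b}) \ (A * B)).card * ((({b} : Finset G) • Y) \ (B • Y)).card := by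
  rw [← Finset.card_product]
  refine (Finset.card_le_card ?_).trans
    (Finset.card_image_le (f := fun w : G × X => (w.1 * b⁻¹) • w.2))
  intro z hz
  obtain ⟨hz, hz'⟩ := Finset.mem_sdiff.1 hz
  obtain ⟨u, hu, y, hy, rfl⟩ := Finset.mem_smul.1 hz
  obtain ⟨a, ha, b', hb', rfl⟩ := Finset.mem_mul.1 hu
  obtain rfl := Finset.mem_singleton.1 hb'
  refine Finset.mem_image.2 ⟨(a * b', b' • y), Finset.mem_product.2
    ⟨Finset.mem_sdiff.2 ⟨hu, fun h => hz' (Finset.smul_mem_smul h hy)⟩,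
      Finset.mem_sdiff.2 ⟨Finset.smul_mem_smul hb' hy, fun h => hz' ?_⟩⟩, ?_⟩
  · rw [mul_smul, mul_smul]
    exact Finset.smul_mem_smul ha h
  · simp [mul_smul]

theorem card_mul_smul_sq_le {G X : Type*} [Group G] [MulAction G X] [DecidableEq G]
    [DecidableEq X] (A B : Finset G) (Y : Finset X) (M : ℕ)
    (hM : ∀ b ∈ B, ((A * {b}) • Y).card ≤ M) :
    ((A * B) • Y).card ^ 2 ≤ (A * B).card * ((B • Y).card * M) := by
  induction B using Finset.induction_on with
  | empty => simp
  | insert b B _ ih =>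
    have hN := ih fun c hc => hM c (Finset.mem_insert_of_mem hc)
    have hn : (((A * {b}) • Y) \ ((A * B) • Y)).card ^ 2 ≤
        ((A * {b}) \ (A * B)).card * (((({b} : Finset G) • Y) \ (B • Y)).card * M) := by
      rw [sq, ← mul_assoc]
      exact Nat.mul_le_mul (card_smul_sdiff_le_mul A B Y b)
        ((Finset.card_le_card Finset.sdiff_subset).trans
          (hM b (Finset.mem_insert_self b B)))
    have h := add_sq_le_mul_add_mul_add hN hn
    simp only [add_comm _ (Finset.card (_ \ _)), Finset.card_sdiff_add_card] at h
    rwa [← Finset.union_smul, ← Finset.union_smul, ← Finset.mul_union,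
      ← Finset.insert_eq] at h

theorem card_mul_singleton_smul_of_commute {G X : Type*} [Group G] [MulAction G X]
    [DecidableEq G] [DecidableEq X] (A : Finset G) (Y : Finset X) (b : G)
    (hb : ∀ a ∈ A, a * b = b * a) : ((A * {b}) • Y).card = (A • Y).card := by
  have hAb : A * {b} = b • A := by
    rw [Finset.mul_singleton]
    exact Finset.image_congr hb
  rw [hAb, smul_assoc, Finset.card_smul_finset]

/-- `|AB · Y|² ≤ |AB| · |B · Y| · max_{b ∈ B} |Ab · Y|`, and when the elements of `A`
commute with those of `B`, `|AB · Y|² ≤ |AB| · |B · Y| · |A · Y|`. -/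
theorem stmt_4 {G X : Type*} [Group G] [MulAction G X] [DecidableEq G] [DecidableEq X]
    (A B : Finset G) (Y : Finset X) (hA : A.Nonempty) (hB : B.Nonempty) (hY : Y.Nonempty) :
    ((A * B) • Y).card ^ 2 ≤
      (A * B).card * ((B • Y).card * B.sup (fun b => ((A * {b}) • Y).card)) ∧
    ((∀ a ∈ A, ∀ b ∈ B, a * b = b * a) →
      ((A * B) • Y).card ^ 2 ≤ (A * B).card * ((B • Y).card * (A • Y).card)) :=
  ⟨card_mul_smul_sq_le A B Y _ fun _ hb =>
      Finset.le_sup (f := fun b => ((A * {b}) • Y).card) hb,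
    fun hcomm => card_mul_smul_sq_le A B Y _ fun b hb =>
      (card_mul_singleton_smul_of_commute A Y b fun a ha => hcomm a ha b hb).le⟩
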